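/- Eberlein's decomposition theorem: every weakly almost periodic function is the sum of an almost periodic function and a function with vanishing quadratic mean. Precisely, if φ ∈ WAP(ℝ^d), then there exist functions φ_* and φ_N with φ = φ_* + φ_N, where φ_* is almost periodic in the Bochner sense (φ_* is bounded uniformly continuous and the set of its translates {φ_*(·+λ) : λ ∈ ℝ^d} is totally bounded in the sup norm), and φ_N is bounded uniformly continuous with lim_{R→∞} (1/|B(0,R)|) ∫_{B(0,R)} |φ_N(y)|² dy = 0. -/

import Mathlib

open MeasureTheory Filter Topology

/-- The translate of a bounded continuous function `f` by `l`: the function `x ↦ f (x + l)`. -/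
noncomputable def translateBCF {d : ℕ}
    (f : BoundedContinuousFunction (EuclideanSpace ℝ (Fin d)) ℝ)
    (l : EuclideanSpace ℝ (Fin d)) :
    BoundedContinuousFunction (EuclideanSpace ℝ (Fin d)) ℝ :=
  f.compContinuous ⟨fun x => x + l, by continuity⟩

/-- `f` is weakly almost periodic: every sequence of translates has a subsequence converging
in the weak topology of the Banach space of bounded continuous functions. -/
def IsWAP {d : ℕ} (f : BoundedContinuousFunction (EuclideanSpace ℝ (Fin d)) ℝ) : Prop :=
  ∀ lam : ℕ → EuclideanSpace ℝ (Fin d),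
    ∃ (φ : ℕ → ℕ) (g : BoundedContinuousFunction (EuclideanSpace ℝ (Fin d)) ℝ),
      StrictMono φ ∧
      ∀ Φ : BoundedContinuousFunction (EuclideanSpace ℝ (Fin d)) ℝ →L[ℝ] ℝ,
        Tendsto (fun j => Φ (translateBCF f (lam (φ j)))) atTop (𝓝 (Φ g))

/-- `f` is almost periodic in the Bochner sense: `f` is (bounded and) uniformly continuous and
its set of translates is totally bounded in the sup norm. -/
def IsAP {d : ℕ} (f : BoundedContinuousFunction (EuclideanSpace ℝ (Fin d)) ℝ) : Prop :=
  UniformContinuous ⇑f ∧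
  TotallyBounded {g : BoundedContinuousFunction (EuclideanSpace ℝ (Fin d)) ℝ |
    ∃ l : EuclideanSpace ℝ (Fin d), g = translateBCF f l}

section WeaklyAlmostPeriodic

open Set TopologicalSpace
open scoped BoundedContinuousFunction

variable {d : ℕ}

/-- The translation `x ↦ x + l` as a continuous map. -/
noncomputable def translation (l : EuclideanSpace ℝ (Fin d)) :
    C(EuclideanSpace ℝ (Fin d), EuclideanSpace ℝ (Fin d)) :=
  ⟨fun x => x + l, by fun_prop⟩

@[simp]
lemma translation_apply (l x : EuclideanSpace ℝ (Fin d)) : translation l x = x + l := rfl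

@[simp]
lemma translateBCF_apply (f : EuclideanSpace ℝ (Fin d) →ᵇ ℝ) (l x : EuclideanSpace ℝ (Fin d)) :
    translateBCF f l x = f (x + l) := rfl

lemma translateBCF_translateBCF (f : EuclideanSpace ℝ (Fin d) →ᵇ ℝ)
    (l m : EuclideanSpace ℝ (Fin d)) :
    translateBCF (translateBCF f l) m = translateBCF f (m + l) := by
  ext x; simp [add_assoc]

@[simp]
lemma translateBCF_zero (f : EuclideanSpace ℝ (Fin d) →ᵇ ℝ) : translateBCF f 0 = f := by
  ext x; simp

lemma dist_translateBCF (f g : EuclideanSpace ℝ (Fin d) →ᵇ ℝ) (l : EuclideanSpace ℝ (Fin d)) :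
    dist (translateBCF f l) (translateBCF g l) = dist f g := by
  apply le_antisymm
  · exact (BoundedContinuousFunction.dist_le dist_nonneg).2 fun x =>
      BoundedContinuousFunction.dist_coe_le_dist (x + l)
  · refine (BoundedContinuousFunction.dist_le dist_nonneg).2 fun x => ?_
    simpa using BoundedContinuousFunction.dist_coe_le_dist (f := translateBCF f l)
      (g := translateBCF g l) (x - l)

/-- A closed convex set is closed under weak sequential limits. -/
lemma Convex.mem_of_tendsto_weak {B : Type*} [NormedAddCommGroup B] [NormedSpace ℝ B]
    {s : Set B} (hs : Convex ℝ s) (hc : IsClosed s) {w : ℕ → B} {g : B} (hw : ∀ n, w n ∈ s)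
    (h : ∀ Φ : B →L[ℝ] ℝ, Tendsto (fun n => Φ (w n)) atTop (𝓝 (Φ g))) : g ∈ s := by
  by_contra hg
  obtain ⟨Φ, u, hu, hug⟩ := geometric_hahn_banach_closed_point hs hc hg
  exact hug.not_ge (le_of_tendsto (h Φ) (Eventually.of_forall fun n => (hu _ (hw n)).le))

/-- The closed linear span of a dense countable set of translates of a function. -/
noncomputable def translateSpan (f : EuclideanSpace ℝ (Fin d) →ᵇ ℝ) :
    Set (EuclideanSpace ℝ (Fin d) →ᵇ ℝ) :=
  closure (Submodule.span ℝ
    (range fun n => translateBCF f (denseSeq (EuclideanSpace ℝ (Fin d)) n)))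

lemma isSeparable_translateSpan (f : EuclideanSpace ℝ (Fin d) →ᵇ ℝ) :
    IsSeparable (translateSpan f) :=
  (countable_range _).isSeparable.span.closure

lemma convex_translateSpan (f : EuclideanSpace ℝ (Fin d) →ᵇ ℝ) : Convex ℝ (translateSpan f) :=
  (Submodule.convex _).closure

lemma IsWAP.translate_mem_translateSpan {f : EuclideanSpace ℝ (Fin d) →ᵇ ℝ} (hf : IsWAP f)
    (l : EuclideanSpace ℝ (Fin d)) : translateBCF f l ∈ translateSpan f := by
  obtain ⟨q, hq, hql⟩ := mem_closure_iff_seq_limit.1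
    ((denseRange_denseSeq (EuclideanSpace ℝ (Fin d))).closure_range ▸ mem_univ l :
      l ∈ closure (range (denseSeq (EuclideanSpace ℝ (Fin d)))))
  obtain ⟨k, g, hk, hg⟩ := hf q
  have hgl : g = translateBCF f l := by
    ext x
    refine tendsto_nhds_unique (hg (BoundedContinuousFunction.evalCLM ℝ x)) ?_
    have : Tendsto (fun j => x + q (k j)) atTop (𝓝 (x + l)) :=
      (hql.comp hk.tendsto_atTop).const_add x
    exact (f.continuous.tendsto (x + l)).comp this
  rw [← hgl]
  refine (convex_translateSpan f).mem_of_tendsto_weak isClosed_closure (fun j => ?_) hg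
  obtain ⟨n, hn⟩ := hq (k j)
  exact subset_closure (Submodule.subset_span ⟨n, by simp only [hn]⟩)

/-- A separable set lies in a countable union of closed balls of any given radius. -/
lemma IsSeparable.exists_seq_dist_le {B : Type*} [PseudoMetricSpace B] [Nonempty B] {s : Set B}
    (hs : IsSeparable s) {ε : ℝ} (hε : 0 < ε) :
    ∃ v : ℕ → B, ∀ g ∈ s, ∃ n, dist g (v n) ≤ ε := by
  obtain ⟨c, hc, hsc⟩ := hs
  obtain ⟨b⟩ := ‹Nonempty B›
  obtain ⟨v, hv⟩ := (hc.insert b).exists_eq_range (insert_nonempty _ _)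
  refine ⟨v, fun g hg => ?_⟩
  obtain ⟨y, hy, hgy⟩ := Metric.mem_closure_iff.1 (hsc hg) ε hε
  obtain ⟨n, rfl⟩ : y ∈ range v := hv ▸ mem_insert_of_mem _ hy
  exact ⟨n, hgy.le⟩

lemma isClosed_dist_translateBCF_le (f v : EuclideanSpace ℝ (Fin d) →ᵇ ℝ) {ε : ℝ} (hε : 0 ≤ ε) :
    IsClosed {l | dist (translateBCF f l) v ≤ ε} := by
  simp only [BoundedContinuousFunction.dist_le hε, ofPred_forall]
  refine isClosed_iInter fun x => isClosed_le ?_ continuous_const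
  simp only [translateBCF_apply]
  fun_prop

/-- A bounded continuous function with norm-separable orbit moves norm-continuously under
translations. -/
lemma tendsto_dist_translateBCF_of_isSeparable {f : EuclideanSpace ℝ (Fin d) →ᵇ ℝ}
    (hf : IsSeparable (range (translateBCF f))) :
    Tendsto (fun h => dist (translateBCF f h) f) (𝓝 0) (𝓝 0) := by
  rw [Metric.tendsto_nhds]
  intro ε hε
  obtain ⟨v, hv⟩ := IsSeparable.exists_seq_dist_le hf (show 0 < ε / 3 by positivity)
  obtain ⟨n, l, hl⟩ := nonempty_interior_of_iUnion_of_closed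
    (fun n => isClosed_dist_translateBCF_le f (v n) (show 0 ≤ ε / 3 by positivity))
    (by simpa [eq_univ_iff_forall] using fun l => hv _ ⟨l, rfl⟩)
  have hnear : Tendsto (fun h => l + h) (𝓝 0) (𝓝 l) := by
    simpa using (continuous_const_add l).tendsto 0
  filter_upwards [hnear (mem_interior_iff_mem_nhds.1 hl)] with h hh
  have h1 : dist (translateBCF f (l + h)) (v n) ≤ ε / 3 := hh
  have h2 : dist (translateBCF f l) (v n) ≤ ε / 3 := by
    have := interior_subset hl
    exact this
  have h3 := dist_triangle_right (translateBCF f (l + h)) (translateBCF f l) (v n)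
  rw [← translateBCF_translateBCF, dist_translateBCF] at h3
  rw [← translateBCF_translateBCF] at h1
  rw [Real.dist_0_eq_abs, abs_of_nonneg dist_nonneg]
  linarith

lemma uniformContinuous_of_isSeparable {f : EuclideanSpace ℝ (Fin d) →ᵇ ℝ}
    (hf : IsSeparable (range (translateBCF f))) : UniformContinuous f := by
  rw [Metric.uniformContinuous_iff]
  intro ε hε
  obtain ⟨δ, hδ, h⟩ := Metric.eventually_nhds_iff.1
    (Metric.tendsto_nhds.1 (tendsto_dist_translateBCF_of_isSeparable hf) ε hε)
  refine ⟨δ, hδ, fun {a b} hab => ?_⟩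
  have h1 := h (y := a - b) (by simpa [dist_eq_norm] using hab)
  rw [Real.dist_0_eq_abs, abs_of_nonneg dist_nonneg] at h1
  have h2 := BoundedContinuousFunction.dist_coe_le_dist (f := translateBCF f (a - b)) (g := f) b
  simp only [translateBCF_apply, add_sub_cancel] at h2
  exact h2.trans_lt h1

lemma IsWAP.isSeparable {f : EuclideanSpace ℝ (Fin d) →ᵇ ℝ} (hf : IsWAP f) :
    IsSeparable (range (translateBCF f)) :=
  (isSeparable_translateSpan f).mono (range_subset_iff.2 hf.translate_mem_translateSpan)

lemma isAP_of_totallyBounded {f : EuclideanSpace ℝ (Fin d) →ᵇ ℝ}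
    (hf : TotallyBounded (range (translateBCF f))) : IsAP f := by
  refine ⟨uniformContinuous_of_isSeparable hf.isSeparable, ?_⟩
  convert hf using 1
  ext g
  simp [eq_comm]

/-- The hull of `f`: the closure of the set of its translates for locally uniform convergence. -/
noncomputable def hull (f : EuclideanSpace ℝ (Fin d) →ᵇ ℝ) :
    Set C(EuclideanSpace ℝ (Fin d), ℝ) :=
  closure (range fun l => (translateBCF f l).toContinuousMap)

lemma continuous_comp_translation (l : EuclideanSpace ℝ (Fin d)) :
    Continuous fun y : C(EuclideanSpace ℝ (Fin d), ℝ) => y.comp (translation l) :=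
  ContinuousMap.continuous_precomp _

lemma mapsTo_hull (f : EuclideanSpace ℝ (Fin d) →ᵇ ℝ) (l : EuclideanSpace ℝ (Fin d)) :
    MapsTo (fun y => y.comp (translation l)) (hull f) (hull f) := by
  refine MapsTo.closure ?_ (continuous_comp_translation l)
  rintro _ ⟨m, rfl⟩
  exact ⟨l + m, by ext x; simp [add_assoc]⟩

/-- Translation-equicontinuous bounded families of functions have compact closure for locally
uniform convergence. -/
lemma isCompact_hull {f : EuclideanSpace ℝ (Fin d) →ᵇ ℝ}
    (hf : Tendsto (fun h => dist (translateBCF f h) f) (𝓝 0) (𝓝 0)) : IsCompact (hull f) := by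
  set P : Set (EuclideanSpace ℝ (Fin d) → ℝ) :=
    {y | (∀ x, y x ∈ Icc (-‖f‖) ‖f‖) ∧ ∀ a b, dist (y a) (y b) ≤ dist (translateBCF f (a - b)) f}
    with hP
  set S : Set C(EuclideanSpace ℝ (Fin d), ℝ) := {y | ⇑y ∈ P} with hS
  have hPclosed : IsClosed P := by
    rw [hP]
    simp only [ofPred_and, ofPred_forall]
    refine (isClosed_iInter fun x => isClosed_Icc.preimage (continuous_apply x)).inter
      (isClosed_iInter fun a => isClosed_iInter fun b => ?_)
    exact isClosed_le (by fun_prop) continuous_const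
  have hPcompact : IsCompact P :=
    (isCompact_univ_pi fun _ => isCompact_Icc).of_isClosed_subset hPclosed
      fun y hy x _ => hy.1 x
  have hmod (b : EuclideanSpace ℝ (Fin d)) :
      Tendsto (fun a => dist (translateBCF f (a - b)) f) (𝓝 b) (𝓝 0) := by
    refine hf.comp ?_
    simpa using (continuous_sub_right b).tendsto b
  have hcont : ∀ y ∈ P, Continuous y := fun y hy => continuous_iff_continuousAt.2 fun b =>
    tendsto_iff_dist_tendsto_zero.2 (squeeze_zero (fun _ => dist_nonneg) (fun a => hy.2 a b)
      (hmod b))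
  have himage : ContinuousMap.toFun '' S = P := by
    ext y
    exact ⟨by rintro ⟨y, hy, rfl⟩; exact hy, fun hy => ⟨⟨y, hcont y hy⟩, hy, rfl⟩⟩
  have hequi : Equicontinuous ((↑) : S → EuclideanSpace ℝ (Fin d) → ℝ) := fun b =>
    Metric.equicontinuousAt_of_continuity_modulus _ (hmod b) _
      (Eventually.of_forall fun a y => by rw [dist_comm]; exact y.2.2 a b)
  have hScompact : IsCompact S :=
    ArzelaAscoli.isCompact_of_equicontinuous S (himage ▸ hPcompact) hequi
  refine hScompact.of_isClosed_subset isClosed_closure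
    (closure_minimal ?_ hScompact.isClosed)
  rintro _ ⟨l, rfl⟩
  refine ⟨fun x => abs_le.1 (f.norm_coe_le_norm (x + l)), fun a b => ?_⟩
  have := BoundedContinuousFunction.dist_coe_le_dist (f := translateBCF f (a - b)) (g := f) (b + l)
  rwa [translateBCF_apply, show b + l + (a - b) = a + l by abel] at this

/-- Every element of the hull of a weakly almost periodic function is a weak limit of
translates. -/
lemma IsWAP.exists_tendsto_of_mem_hull {f : EuclideanSpace ℝ (Fin d) →ᵇ ℝ} (hf : IsWAP f)
    {y : C(EuclideanSpace ℝ (Fin d), ℝ)} (hy : y ∈ hull f) :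
    ∃ (l : ℕ → EuclideanSpace ℝ (Fin d)) (g : EuclideanSpace ℝ (Fin d) →ᵇ ℝ),
      g.toContinuousMap = y ∧ ∀ Φ : (EuclideanSpace ℝ (Fin d) →ᵇ ℝ) →L[ℝ] ℝ,
        Tendsto (fun j => Φ (translateBCF f (l j))) atTop (𝓝 (Φ g)) := by
  obtain ⟨w, hw, hwy⟩ := mem_closure_iff_seq_limit.1 hy
  choose l hl using hw
  obtain ⟨k, g, hk, hg⟩ := hf l
  refine ⟨l ∘ k, g, ?_, hg⟩
  ext x
  refine tendsto_nhds_unique (hg (BoundedContinuousFunction.evalCLM ℝ x)) ?_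
  have := ((ContinuousEvalConst.continuous_eval_const x).tendsto y).comp
    (hwy.comp hk.tendsto_atTop)
  refine this.congr fun j => ?_
  simp only [Function.comp_apply, ← hl]
  rfl

/-- A nonempty compact set invariant under a family of maps contains a minimal nonempty closed
invariant subset. -/
lemma IsCompact.exists_minimal_closed_invariant {Z ι : Type*} [TopologicalSpace Z] [T2Space Z]
    (T : ι → Z → Z) {K : Set Z} (hK : IsCompact K) (hne : K.Nonempty)
    (hT : ∀ i, MapsTo (T i) K K) :
    ∃ M ⊆ K, Minimal (fun N => IsClosed N ∧ N.Nonempty ∧ ∀ i, MapsTo (T i) N N) M := by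
  obtain ⟨M, hMK, hM⟩ := zorn_superset_nonempty
    {N | N ⊆ K ∧ IsClosed N ∧ N.Nonempty ∧ ∀ i, MapsTo (T i) N N} (fun c hc hchain hcne => by
      have : Nonempty c := hcne.to_subtype
      obtain ⟨N, hN⟩ := hcne
      refine ⟨⋂₀ c, ⟨(sInter_subset_of_mem hN).trans (hc hN).1,
        isClosed_sInter fun N hN => (hc hN).2.1, ?_, fun i x hx N hN =>
          (hc hN).2.2.2 i (hx N hN)⟩, fun s hs => sInter_subset_of_mem hs⟩
      exact IsCompact.nonempty_sInter_of_directed_nonempty_isCompact_isClosed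
        (fun a ha b hb => (hchain.total ha hb).elim (fun h => ⟨a, ha, Subset.rfl, h⟩)
          fun h => ⟨b, hb, h, Subset.rfl⟩)
        (fun N hN => (hc hN).2.2.1)
        (fun N hN => hK.of_isClosed_subset (hc hN).2.1 (hc hN).1) (fun N hN => (hc hN).2.1))
    K ⟨Subset.rfl, hK.isClosed, hne, hT⟩
  exact ⟨M, hMK, hM.prop.2, fun N hN hNM => hM.le_of_le ⟨hNM.trans hMK, hN⟩ hNM⟩

/-- In a minimal compact invariant set whose elements are covered by countably many sup-norm balls
of each radius, finitely many sup-norm balls of each radius suffice. -/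
lemma exists_finite_net_of_minimal {M : Set C(EuclideanSpace ℝ (Fin d), ℝ)} (hMc : IsCompact M)
    (hM : Minimal (fun N : Set C(EuclideanSpace ℝ (Fin d), ℝ) => IsClosed N ∧ N.Nonempty ∧
      ∀ l, MapsTo (fun y => y.comp (translation l)) N N) M) {ε : ℝ}
    (v : ℕ → EuclideanSpace ℝ (Fin d) →ᵇ ℝ)
    (hv : ∀ y ∈ M, ∃ n, ∀ x, dist (y x) (v n x) ≤ ε) :
    ∃ t : Set (EuclideanSpace ℝ (Fin d) →ᵇ ℝ), t.Finite ∧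
      ∀ y ∈ M, ∃ w ∈ t, ∀ x, dist (y x) (w x) ≤ ε := by
  obtain ⟨hMcl, hMne, hMinv⟩ := hM.prop
  have : CompactSpace M := isCompact_iff_compactSpace.1 hMc
  have : Nonempty M := hMne.to_subtype
  obtain ⟨n, hn⟩ := nonempty_interior_of_iUnion_of_closed
    (f := fun n => {y : M | ∀ x, dist (y.1 x) (v n x) ≤ ε})
    (fun n => by
      simp only [ofPred_forall]
      refine isClosed_iInter fun x => isClosed_le ?_ continuous_const
      exact ((ContinuousEvalConst.continuous_eval_const x).comp continuous_subtype_val).dist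
        continuous_const)
    (by simpa [eq_univ_iff_forall] using hv)
  obtain ⟨U, hU, hUn⟩ := isOpen_induced_iff.1 (isOpen_interior (X := M)
    (s := {y : M | ∀ x, dist (y.1 x) (v n x) ≤ ε}))
  have hUball : ∀ y ∈ M, y ∈ U → ∀ x, dist (y x) (v n x) ≤ ε := fun y hy hyU => by
    have h : (⟨y, hy⟩ : M) ∈ Subtype.val ⁻¹' U := hyU
    rw [hUn] at h
    have := interior_subset h
    exact this
  have hreach : ∀ y ∈ M, ∃ l, y.comp (translation l) ∈ U := by
    by_contra! hcon
    obtain ⟨y, hy, hyU⟩ := hcon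
    set N : Set C(EuclideanSpace ℝ (Fin d), ℝ) := M ∩ {y | ∀ l, y.comp (translation l) ∈ Uᶜ}
    have hN : IsClosed N ∧ N.Nonempty ∧ ∀ l, MapsTo (fun y => y.comp (translation l)) N N := by
      refine ⟨hMcl.inter ?_, ⟨y, hy, hyU⟩, fun l z hz => ⟨hMinv l hz.1, fun m => ?_⟩⟩
      · simp only [ofPred_forall]
        exact isClosed_iInter fun l => hU.isClosed_compl.preimage (continuous_comp_translation l)
      · convert hz.2 (m + l) using 1
        ext x
        simp [add_assoc]
    obtain ⟨z, hz⟩ := hn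
    have hzU : z.1 ∈ U := by rwa [← hUn] at hz
    have := (hM.le_of_le hN inter_subset_left z.2).2 0
    rw [show z.1.comp (translation 0) = z.1 by ext x; simp] at this
    exact this hzU
  obtain ⟨s, hs⟩ := hMc.elim_finite_subcover
    (fun l => (fun y : C(EuclideanSpace ℝ (Fin d), ℝ) => y.comp (translation l)) ⁻¹' U)
    (fun l => hU.preimage (continuous_comp_translation l))
    (fun y hy => mem_iUnion.2 (hreach y hy))
  refine ⟨(fun l => translateBCF (v n) (-l)) '' s, s.finite_toSet.image _, fun y hy => ?_⟩
  obtain ⟨l, hl, hyl⟩ := mem_iUnion₂.1 (hs hy)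
  refine ⟨_, ⟨l, hl, rfl⟩, fun x => ?_⟩
  simpa using hUball _ (hMinv l hy) hyl (x + -l)

/-- The translates of a weakly almost periodic function accumulate weakly at a function with
totally bounded orbit. -/
lemma IsWAP.exists_tendsto_totallyBounded {f : EuclideanSpace ℝ (Fin d) →ᵇ ℝ} (hf : IsWAP f) :
    ∃ (l : ℕ → EuclideanSpace ℝ (Fin d)) (g : EuclideanSpace ℝ (Fin d) →ᵇ ℝ),
      TotallyBounded (range (translateBCF g)) ∧
      ∀ Φ : (EuclideanSpace ℝ (Fin d) →ᵇ ℝ) →L[ℝ] ℝ,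
        Tendsto (fun j => Φ (translateBCF f (l j))) atTop (𝓝 (Φ g)) := by
  have hK := isCompact_hull (tendsto_dist_translateBCF_of_isSeparable hf.isSeparable)
  obtain ⟨M, hMK, hM⟩ := hK.exists_minimal_closed_invariant
    (fun l (y : C(EuclideanSpace ℝ (Fin d), ℝ)) => y.comp (translation l))
    (range_nonempty _).closure (mapsTo_hull f)
  obtain ⟨hMcl, ⟨y, hy⟩, hMinv⟩ := hM.prop
  obtain ⟨l, g, hgy, hg⟩ := hf.exists_tendsto_of_mem_hull (hMK hy)
  refine ⟨l, g, Metric.totallyBounded_iff.2 fun ε hε => ?_, hg⟩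
  obtain ⟨v, hv⟩ := IsSeparable.exists_seq_dist_le (isSeparable_translateSpan f) (half_pos hε)
  obtain ⟨t, ht, hMt⟩ := exists_finite_net_of_minimal (hK.of_isClosed_subset hMcl hMK) hM v
    (ε := ε / 2) fun z hz => by
      obtain ⟨m, u, rfl, hu⟩ := hf.exists_tendsto_of_mem_hull (hMK hz)
      obtain ⟨n, hn⟩ := hv u ((convex_translateSpan f).mem_of_tendsto_weak isClosed_closure
        (fun j => hf.translate_mem_translateSpan (m j)) hu)
      exact ⟨n, (BoundedContinuousFunction.dist_le (half_pos hε).le).1 hn⟩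
  refine ⟨t, ht, ?_⟩
  rintro _ ⟨m, rfl⟩
  obtain ⟨w, hw, hmw⟩ := hMt _ (hMinv m hy)
  refine mem_iUnion₂.2 ⟨w, hw, ?_⟩
  have : dist (translateBCF g m) w ≤ ε / 2 :=
    (BoundedContinuousFunction.dist_le (half_pos hε).le).2 (by rw [← hgy] at hmw; exact hmw)
  exact Metric.mem_ball.2 (this.trans_lt (half_lt_self hε))

/-- A weakly almost periodic function is the sum of a function with totally bounded orbit and a
function some sequence of whose translates is weakly null. -/
lemma IsWAP.exists_add_weakly_null {f : EuclideanSpace ℝ (Fin d) →ᵇ ℝ} (hf : IsWAP f) :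
    ∃ (p : EuclideanSpace ℝ (Fin d) →ᵇ ℝ) (l : ℕ → EuclideanSpace ℝ (Fin d)),
      TotallyBounded (range (translateBCF p)) ∧
      ∀ Φ : (EuclideanSpace ℝ (Fin d) →ᵇ ℝ) →L[ℝ] ℝ,
        Tendsto (fun j => Φ (translateBCF (f - p) (l j))) atTop (𝓝 0) := by
  obtain ⟨l, g, hg, hlim⟩ := hf.exists_tendsto_totallyBounded
  have hcompact : IsCompact (closure (range (translateBCF g))) :=
    hg.closure.isCompact_of_isClosed isClosed_closure
  obtain ⟨p, hp, k, hk, hkp⟩ := hcompact.tendsto_subseq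
    (x := fun n => translateBCF g (-l n)) fun n => subset_closure ⟨_, rfl⟩
  have hiso (m : EuclideanSpace ℝ (Fin d)) : Isometry fun u => translateBCF u m :=
    Isometry.of_dist_eq fun u w => dist_translateBCF u w m
  refine ⟨p, l ∘ k, hg.closure.subset ?_, fun Φ => ?_⟩
  · rintro _ ⟨m, rfl⟩
    refine MapsTo.closure (f := fun u => translateBCF u m) ?_ (hiso m).continuous hp
    rintro _ ⟨r, rfl⟩
    exact ⟨m + r, (translateBCF_translateBCF g r m).symm⟩
  · have hnorm : Tendsto (fun j => translateBCF p (l (k j))) atTop (𝓝 g) := by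
      rw [tendsto_iff_dist_tendsto_zero] at hkp ⊢
      refine hkp.congr fun j => ?_
      rw [Function.comp_apply, ← dist_translateBCF _ p (l (k j)), translateBCF_translateBCF,
        add_neg_cancel, translateBCF_zero, dist_comm]
    have h := ((hlim Φ).comp hk.tendsto_atTop).sub ((Φ.continuous.tendsto g).comp hnorm)
    rw [sub_self] at h
    refine h.congr fun j => ?_
    simp only [Function.comp_apply, ← map_sub]
    rfl

/-- Points of the closure of the joint image of a weakly null sequence of bounded continuous
functions are null sequences. -/
lemma tendsto_zero_of_mem_closure_range {X : Type*} [TopologicalSpace X] {w : ℕ → X →ᵇ ℝ}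
    (hw : ∀ Φ : (X →ᵇ ℝ) →L[ℝ] ℝ, Tendsto (fun n => Φ (w n)) atTop (𝓝 0)) {q : ℕ → ℝ}
    (hq : q ∈ closure (range fun x n => w n x)) : Tendsto q atTop (𝓝 0) := by
  have : (comap (fun x n => w n x) (𝓝 q)).NeBot := comap_neBot fun t ht => by
    obtain ⟨_, hxt, x, rfl⟩ := mem_closure_iff_nhds.1 hq t ht
    exact ⟨x, hxt⟩
  let 𝓖 : Ultrafilter X := Ultrafilter.of (comap (fun x n => w n x) (𝓝 q))
  have h𝓖 : Tendsto (fun x n => w n x) 𝓖 (𝓝 q) := tendsto_comap.mono_left (Ultrafilter.of_le _)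
  let ev : X → WeakDual ℝ (X →ᵇ ℝ) := fun x =>
    StrongDual.toWeakDual (BoundedContinuousFunction.evalCLM ℝ x)
  obtain ⟨Φ, -, hΦ⟩ := (WeakDual.isCompact_closedBall (0 : StrongDual ℝ (X →ᵇ ℝ))
    1).ultrafilter_le_nhds (𝓖.map ev) (by
      rw [le_principal_iff, Ultrafilter.mem_coe, Ultrafilter.mem_map]
      refine univ_mem' fun x => mem_closedBall_zero_iff.2 ?_
      exact ContinuousLinearMap.opNorm_le_bound _ zero_le_one fun f => by
        simpa [ev] using f.norm_coe_le_norm x)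
  have hΦ : Tendsto ev 𝓖 (𝓝 Φ) := hΦ
  refine (hw (WeakDual.toStrongDual Φ)).congr fun n => ?_
  refine tendsto_nhds_unique (((WeakDual.eval_continuous (w n)).tendsto Φ).comp hΦ) ?_
  exact (tendsto_pi_nhds.1 h𝓖) n

/-- Enlarging balls by a fixed amount does not change their volume asymptotically. -/
lemma tendsto_volume_ball_ratio (r : ℝ) :
    Tendsto (fun R : ℝ => volume.real (Metric.ball (0 : EuclideanSpace ℝ (Fin d)) (R - r)) /
      volume.real (Metric.ball (0 : EuclideanSpace ℝ (Fin d)) R)) atTop (𝓝 1) := by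
  have h : Tendsto (fun R : ℝ => (1 - r / R) ^ d) atTop (𝓝 1) := by
    simpa using ((tendsto_const_nhds (x := r)).div_atTop tendsto_id).const_sub 1 |>.pow d
  refine h.congr' ?_
  filter_upwards [eventually_gt_atTop 0, eventually_gt_atTop r] with R hR hRr
  have hone : volume.real (Metric.ball (0 : EuclideanSpace ℝ (Fin d)) 1) ≠ 0 :=
    (ENNReal.toReal_pos (Metric.measure_ball_pos _ _ one_pos).ne' measure_ball_lt_top.ne).ne'
  have hball {s : ℝ} (hs : 0 < s) : volume.real (Metric.ball (0 : EuclideanSpace ℝ (Fin d)) s) =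
      s ^ d * volume.real (Metric.ball (0 : EuclideanSpace ℝ (Fin d)) 1) := by
    rw [measureReal_def, Measure.addHaar_ball_of_pos _ _ hs, ENNReal.toReal_mul,
      ENNReal.toReal_ofReal (by positivity), finrank_euclideanSpace_fin]
    rfl
  rw [hball hR, hball (sub_pos.2 hRr), mul_div_mul_right _ _ hone, ← div_pow, sub_div,
    div_self (ne_of_gt hR)]

/-- Averages of a nonnegative bounded function over large balls do not decrease by more than a
vanishing amount under translation. -/
lemma average_ball_le_average_translateBCF_add (f : EuclideanSpace ℝ (Fin d) →ᵇ ℝ)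
    (hf : ∀ x, 0 ≤ f x) (l : EuclideanSpace ℝ (Fin d)) {R : ℝ} (hR : 0 < R) :
    ⨍ y in Metric.ball (0 : EuclideanSpace ℝ (Fin d)) R, f y ≤
      (⨍ y in Metric.ball (0 : EuclideanSpace ℝ (Fin d)) R, translateBCF f l y) +
        ‖f‖ * (1 - volume.real (Metric.ball (0 : EuclideanSpace ℝ (Fin d)) (R - ‖l‖)) /
          volume.real (Metric.ball (0 : EuclideanSpace ℝ (Fin d)) R)) := by
  have hint (x : EuclideanSpace ℝ (Fin d)) (s : ℝ) : IntegrableOn f (Metric.ball x s) :=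
    (f.continuous.continuousOn.integrableOn_compact (isCompact_closedBall x s)).mono_set
      Metric.ball_subset_closedBall
  have hsub : Metric.ball (0 : EuclideanSpace ℝ (Fin d)) (R - ‖l‖) ⊆ Metric.ball 0 R :=
    Metric.ball_subset_ball (by linarith [norm_nonneg l])
  have hpos : 0 < volume.real (Metric.ball (0 : EuclideanSpace ℝ (Fin d)) R) :=
    ENNReal.toReal_pos (Metric.measure_ball_pos _ _ hR).ne' measure_ball_lt_top.ne
  have htrans : ∫ y in Metric.ball (0 : EuclideanSpace ℝ (Fin d)) R, translateBCF f l y =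
      ∫ y in Metric.ball l R, f y := by
    have := (measurePreserving_add_right (volume : Measure (EuclideanSpace ℝ (Fin d)))
      l).setIntegral_preimage_emb (measurableEmbedding_addRight l) f (Metric.ball l R)
    rw [← this]
    congr 2
    ext x
    simp [dist_eq_norm]
  have h1 : ∫ y in Metric.ball (0 : EuclideanSpace ℝ (Fin d)) (R - ‖l‖), f y ≤
      ∫ y in Metric.ball l R, f y :=
    setIntegral_mono_set (hint _ _) (Eventually.of_forall hf)
      (LE.le.eventuallyLE (Metric.ball_subset_ball' (by simp)))
  have h2 : ∫ y in Metric.ball 0 R \ Metric.ball (0 : EuclideanSpace ℝ (Fin d)) (R - ‖l‖), f y ≤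
      ‖f‖ * (volume.real (Metric.ball (0 : EuclideanSpace ℝ (Fin d)) R) -
        volume.real (Metric.ball (0 : EuclideanSpace ℝ (Fin d)) (R - ‖l‖))) := by
    rw [← measureReal_sdiff hsub measurableSet_ball]
    exact (le_abs_self _).trans (norm_setIntegral_le_of_norm_le_const
      ((measure_mono sdiff_subset).trans_lt measure_ball_lt_top)
      fun x _ => f.norm_coe_le_norm x)
  rw [setIntegral_sdiff measurableSet_ball (hint _ _) hsub] at h2
  rw [setAverage_eq, setAverage_eq, htrans, smul_eq_mul, smul_eq_mul]
  field_simp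
  linarith

/-- If some sequence of translates of `u` is weakly null, then `u` has vanishing quadratic mean. -/
lemma tendsto_average_sq_of_weakly_null (u : EuclideanSpace ℝ (Fin d) →ᵇ ℝ)
    (l : ℕ → EuclideanSpace ℝ (Fin d))
    (hu : ∀ Φ : (EuclideanSpace ℝ (Fin d) →ᵇ ℝ) →L[ℝ] ℝ,
      Tendsto (fun n => Φ (translateBCF u (l n))) atTop (𝓝 0)) :
    Tendsto (fun R : ℝ => ⨍ y in Metric.ball (0 : EuclideanSpace ℝ (Fin d)) R, |u y| ^ 2)
      atTop (𝓝 0) := by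
  let θ : EuclideanSpace ℝ (Fin d) → ℕ → ℝ := fun x n => translateBCF u (l n) x
  have hθ : Continuous θ := continuous_pi fun n => (translateBCF u (l n)).continuous
  let K : Set (ℕ → ℝ) := closure (range θ)
  have hKbox : K ⊆ univ.pi fun _ => Icc (-‖u‖) ‖u‖ := by
    refine closure_minimal ?_ (isClosed_set_pi fun _ _ => isClosed_Icc)
    rintro _ ⟨x, rfl⟩ n _
    exact abs_le.1 (u.norm_coe_le_norm _)
  have : CompactSpace K := isCompact_iff_compactSpace.1
    ((isCompact_univ_pi fun _ => isCompact_Icc).of_isClosed_subset isClosed_closure hKbox)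
  let Θ : EuclideanSpace ℝ (Fin d) → K := fun x => ⟨θ x, subset_closure ⟨x, rfl⟩⟩
  have hΘ : Continuous Θ := hθ.subtype_mk _
  rw [tendsto_iff_ultrafilter]
  intro 𝓕 h𝓕
  have hprob (R : ℝ) : ∃ ν : ProbabilityMeasure K, 0 < R → ∀ F : K →ᵇ ℝ,
      ∫ q, F q ∂(ν : Measure K) =
        ⨍ y in Metric.ball (0 : EuclideanSpace ℝ (Fin d)) R, F (Θ y) := by
    by_cases hR : 0 < R
    · have : IsProbabilityMeasure
          (ProbabilityTheory.cond volume (Metric.ball (0 : EuclideanSpace ℝ (Fin d)) R)) :=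
        ProbabilityTheory.cond_isProbabilityMeasure_of_finite
          (Metric.measure_ball_pos _ _ hR).ne' measure_ball_lt_top.ne
      refine ⟨⟨_, Measure.isProbabilityMeasure_map
        (μ := ProbabilityTheory.cond volume (Metric.ball (0 : EuclideanSpace ℝ (Fin d)) R))
        hΘ.aemeasurable⟩, fun _ F => ?_⟩
      rw [ProbabilityMeasure.coe_mk, integral_map hΘ.aemeasurable
        F.continuous.aestronglyMeasurable, ProbabilityTheory.cond, integral_smul_measure,
        setAverage_eq, measureReal_def, ENNReal.toReal_inv]
    · exact ⟨⟨Measure.dirac (Θ 0), inferInstance⟩, fun h => absurd h hR⟩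
  choose ν hν using hprob
  obtain ⟨μ, -, hμ⟩ := isCompact_univ.ultrafilter_le_nhds (𝓕.map ν) (by simp)
  have hμ : Tendsto ν 𝓕 (𝓝 μ) := hμ
  have hcoord (n : ℕ) : Continuous fun q : K => (q.1 n) ^ 2 :=
    ((continuous_apply n).comp continuous_subtype_val).pow 2
  have hbound (n : ℕ) (q : K) : ‖(q.1 n) ^ 2‖ ≤ ‖u‖ ^ 2 := by
    rw [norm_pow]
    gcongr
    exact abs_le.2 (hKbox q.2 n (mem_univ n))
  have hlim (n : ℕ) : Tendsto
      (fun R : ℝ => ⨍ y in Metric.ball (0 : EuclideanSpace ℝ (Fin d)) R,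
        (translateBCF u (l n) y) ^ 2) 𝓕 (𝓝 (∫ q : K, (q.1 n) ^ 2 ∂(μ : Measure K))) := by
    refine ((ProbabilityMeasure.tendsto_iff_forall_integral_tendsto.1 hμ)
      (BoundedContinuousFunction.mkOfCompact ⟨_, hcoord n⟩)).congr' ?_
    filter_upwards [h𝓕 (eventually_gt_atTop 0)] with R hR
    exact hν R hR _
  have hzero : Tendsto (fun n => ∫ q : K, (q.1 n) ^ 2 ∂(μ : Measure K)) atTop (𝓝 0) := by
    have := tendsto_integral_of_dominated_convergence (μ := (μ : Measure K))
      (F := fun n (q : K) => (q.1 n) ^ 2) (f := fun _ => 0) (fun _ => ‖u‖ ^ 2)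
      (fun n => (hcoord n).aestronglyMeasurable) (integrable_const _)
      (fun n => Eventually.of_forall (hbound n))
      (Eventually.of_forall fun q => by
        simpa using (tendsto_zero_of_mem_closure_range hu q.2).pow 2)
    simpa using this
  rw [Metric.tendsto_nhds]
  intro ε hε
  obtain ⟨n, hn⟩ := (hzero.eventually (gt_mem_nhds (half_pos hε))).exists
  have herr : Tendsto (fun R : ℝ => ‖u * u‖ *
      (1 - volume.real (Metric.ball (0 : EuclideanSpace ℝ (Fin d)) (R - ‖l n‖)) /
        volume.real (Metric.ball (0 : EuclideanSpace ℝ (Fin d)) R))) 𝓕 (𝓝 0) := by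
    simpa using (((tendsto_volume_ball_ratio (d := d) ‖l n‖).mono_left h𝓕).const_sub 1).const_mul
      ‖u * u‖
  filter_upwards [(hlim n).eventually (gt_mem_nhds hn), herr.eventually (gt_mem_nhds (half_pos hε)),
    h𝓕 (eventually_gt_atTop 0)] with R h1 h2 hR
  have h3 := average_ball_le_average_translateBCF_add (u * u) (fun x => mul_self_nonneg (u x))
    (l n) hR
  simp only [translateBCF_apply, BoundedContinuousFunction.mul_apply] at h1 h3
  simp only [← pow_two (u _)] at h3
  have h4 : 0 ≤ ⨍ y in Metric.ball (0 : EuclideanSpace ℝ (Fin d)) R, (u y) ^ 2 :=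
    integral_nonneg fun y => sq_nonneg _
  simp only [sq_abs, Real.dist_0_eq_abs, abs_of_nonneg h4]
  linarith

end WeaklyAlmostPeriodic

/-- Eberlein's decomposition theorem: every weakly almost periodic function is the sum of a
Bochner almost periodic function and a bounded uniformly continuous function with vanishing
quadratic mean. -/
theorem eberlein_decomposition {d : ℕ}
    (φ : BoundedContinuousFunction (EuclideanSpace ℝ (Fin d)) ℝ)
    (hφ : IsWAP φ) :
    ∃ φs φN : BoundedContinuousFunction (EuclideanSpace ℝ (Fin d)) ℝ,
      φ = φs + φN ∧ IsAP φs ∧ UniformContinuous ⇑φN ∧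
      Tendsto (fun R : ℝ =>
          ⨍ y in Metric.ball (0 : EuclideanSpace ℝ (Fin d)) R, |φN y| ^ 2)
        atTop (𝓝 0) := by
  obtain ⟨p, l, hp, hl⟩ := hφ.exists_add_weakly_null
  have hAP := isAP_of_totallyBounded hp
  exact ⟨p, φ - p, (add_sub_cancel p φ).symm, hAP,
    (uniformContinuous_of_isSeparable hφ.isSeparable).sub hAP.1,
    tendsto_average_sq_of_weakly_null _ l hl⟩
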